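/- For smooth solutions (A,Q) with A > 0 of the system ∂_t A + ∂_x Q = 0, ∂_t Q + ∂_x (Q²/A + c²A) = −gA ∂_x Z, the entropy E(A,Q) = Q²/(2A) + gAZ + c²A ln A satisfies the identity ∂_t E + ∂_x [u(E + c²A)] = 0, where u = Q/A. -/

import Mathlib

open Real

/-- For smooth solutions `(A,Q)` with `A > 0` of the frictionless pressurised flow system,
the entropy `E = Q²/(2A) + gAZ + c²A ln A` satisfies the identity
`∂ₜ E + ∂ₓ [u (E + c²A)] = 0` with `u = Q/A`. -/
theorem entropy_identity (c g : ℝ) (hc : 0 < c) (hg : 0 < g)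
    (Z : ℝ → ℝ) (hZ : ContDiff ℝ (⊤ : ℕ∞) Z)
    (A Q : ℝ → ℝ → ℝ)
    (hA : ContDiff ℝ (⊤ : ℕ∞) fun p : ℝ × ℝ => A p.1 p.2)
    (hQ : ContDiff ℝ (⊤ : ℕ∞) fun p : ℝ × ℝ => Q p.1 p.2)
    (hApos : ∀ t x, 0 < A t x)
    (mass : ∀ t x, deriv (fun s => A s x) t + deriv (fun y => Q t y) x = 0)
    (mom : ∀ t x, deriv (fun s => Q s x) t +
      deriv (fun y => (Q t y) ^ 2 / A t y + c ^ 2 * A t y) x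
        = -(g * A t x * deriv Z x)) :
    ∀ t x,
      deriv (fun s => (Q s x) ^ 2 / (2 * A s x) + g * A s x * Z x
          + c ^ 2 * A s x * Real.log (A s x)) t
        + deriv (fun y => (Q t y / A t y) *
            (((Q t y) ^ 2 / (2 * A t y) + g * A t y * Z y
              + c ^ 2 * A t y * Real.log (A t y)) + c ^ 2 * A t y)) x = 0 := by
  intro t x
  have hne : A t x ≠ 0 := (hApos t x).ne'
  have dA1 : DifferentiableAt ℝ (fun s => A s x) t := by
    have h : ContDiff ℝ (⊤ : ℕ∞) (fun s : ℝ => A s x) :=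
      hA.comp (contDiff_id.prodMk contDiff_const : ContDiff ℝ (⊤ : ℕ∞) (fun s : ℝ => (s, x)))
    exact h.differentiable (by simp) t
  have dQ1 : DifferentiableAt ℝ (fun s => Q s x) t := by
    have h : ContDiff ℝ (⊤ : ℕ∞) (fun s : ℝ => Q s x) :=
      hQ.comp (contDiff_id.prodMk contDiff_const : ContDiff ℝ (⊤ : ℕ∞) (fun s : ℝ => (s, x)))
    exact h.differentiable (by simp) t
  have dA2 : DifferentiableAt ℝ (fun y => A t y) x := by
    have h : ContDiff ℝ (⊤ : ℕ∞) (fun y : ℝ => A t y) :=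
      hA.comp (contDiff_const.prodMk contDiff_id : ContDiff ℝ (⊤ : ℕ∞) (fun y : ℝ => (t, y)))
    exact h.differentiable (by simp) x
  have dQ2 : DifferentiableAt ℝ (fun y => Q t y) x := by
    have h : ContDiff ℝ (⊤ : ℕ∞) (fun y : ℝ => Q t y) :=
      hQ.comp (contDiff_const.prodMk contDiff_id : ContDiff ℝ (⊤ : ℕ∞) (fun y : ℝ => (t, y)))
    exact h.differentiable (by simp) x
  have dZ : DifferentiableAt ℝ Z x := hZ.differentiable (by simp) x
  have m1 := mass t x
  have m2 := mom t x
  have a1 := dA1.hasDerivAt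
  have q1 := dQ1.hasDerivAt
  have a2 := dA2.hasDerivAt
  have q2 := dQ2.hasDerivAt
  have z := dZ.hasDerivAt
  generalize deriv (fun s => A s x) t = At at *
  generalize deriv (fun s => Q s x) t = Qt at *
  generalize deriv (fun y => A t y) x = Ax at *
  generalize deriv (fun y => Q t y) x = Qx at *
  generalize deriv Z x = Zx at *
  have h2 : (2 * A t x) ≠ 0 := mul_ne_zero two_ne_zero hne
  have e0 := ((q2.fun_pow 2).fun_div a2 hne).fun_add (a2.const_mul (c ^ 2))
  have e1 := (((q1.fun_pow 2).fun_div (a1.const_mul 2) h2).fun_add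
    ((a1.const_mul g).mul_const (Z x))).fun_add ((a1.const_mul (c ^ 2)).fun_mul (a1.log hne))
  have e2 := (q2.fun_div a2 hne).fun_mul (((((q2.fun_pow 2).fun_div (a2.const_mul 2) h2).fun_add
    ((a2.const_mul g).fun_mul z)).fun_add ((a2.const_mul (c ^ 2)).fun_mul (a2.log hne))).fun_add
      (a2.const_mul (c ^ 2)))
  rw [e0.deriv] at m2
  rw [e1.deriv, e2.deriv]
  obtain rfl : At = -Qx := by linarith
  obtain rfl := eq_sub_of_add_eq m2
  generalize Real.log (A t x) = L
  generalize A t x = a at *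
  generalize Q t x = q at *
  field_simp
  push_cast
  ring
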